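/- arXiv:1701.02692 — 9 statements merged into one kernel-verified Lean document; each statement's English description precedes it below -/
import Mathlib

section
/- Every G-equivariant map τ : A^G → A^G maps constant configurations to constant configurations; consequently, if G is a nontrivial group, A is a finite set with at least two elements, τ : A^G → A^G is continuous (for the prodiscrete topology) and G-equivariant, and there is a constant configuration k in the image of τ such that no constant configuration of A^G is mapped to k by τ, then τ is not von Neumann regular in the monoid of all continuous G-equivariant self-maps of A^G: there is no continuous G-equivariant σ : A^G → A^G with τ(σ(τ x)) = τ x for all x ∈ A^G. -/
/-- The right action of `G` on the configuration space `A^G`: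
`(x · g)(h) = x (h * g⁻¹)`. -/
def confShift {G A : Type*} [Group G] (x : G → A) (g : G) : G → A :=
  fun h => x (h * g⁻¹)

/-- A self-map of `A^G` is `G`-equivariant if it commutes with the shift action. -/
def Equivariant {G A : Type*} [Group G] (τ : (G → A) → (G → A)) : Prop :=
  ∀ (x : G → A) (g : G), τ (confShift x g) = confShift (τ x) g

/-- Continuity for the prodiscrete topology on `A^G` (product topology, `A` discrete). -/
def PDContinuous {G A : Type*} [Group G] (τ : (G → A) → (G → A)) : Prop :=
  @Continuous _ _ (@Pi.topologicalSpace G (fun _ => A) (fun _ => ⊥))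
    (@Pi.topologicalSpace G (fun _ => A) (fun _ => ⊥)) τ

/-- every `G`-equivariant map sends constant configurations to
constant configurations; consequently, a continuous `G`-equivariant `τ` having a
constant configuration in its image with no constant preimage is not von Neumann
regular in the monoid of continuous `G`-equivariant self-maps of `A^G`. -/
theorem stmt_1 {G A : Type*} [Group G] [Finite A] :
    (∀ τ : (G → A) → (G → A), Equivariant τ →
      ∀ k : A, ∃ k' : A, τ (fun _ => k) = fun _ => k') ∧
    (Nontrivial G → Nontrivial A →
      ∀ τ : (G → A) → (G → A), PDContinuous τ → Equivariant τ →
      (∃ k : A, (fun _ => k) ∈ Set.range τ ∧ ∀ k' : A, τ (fun _ => k') ≠ fun _ => k) →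
      ¬ ∃ σ : (G → A) → (G → A), PDContinuous σ ∧ Equivariant σ ∧
          ∀ x : G → A, τ (σ (τ x)) = τ x) := by
  have key : ∀ τ : (G → A) → (G → A), Equivariant τ →
      ∀ k : A, ∃ k' : A, τ (fun _ => k) = fun _ => k' := by
    intro τ hτ k
    refine ⟨τ (fun _ => k) 1, ?_⟩
    funext g
    have h := congrFun (hτ (fun _ => k) g) g
    have e : confShift (fun _ : G => k) g = fun _ => k := rfl
    rw [e] at h
    simpa [confShift] using h
  refine ⟨key, ?_⟩
  rintro - - τ - - ⟨k, ⟨x, hx⟩, hk⟩ ⟨σ, -, hσ, h⟩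
  obtain ⟨k', hk'⟩ := key σ hσ k
  apply hk k'
  have := h x
  rwa [hx, hk'] at this
end

section
/- Let G be a group and let A be a finite set. The monoid of all continuous G-equivariant self-maps of A^G (with A^G carrying the prodiscrete topology) is von Neumann regular — i.e. every element τ admits a continuous G-equivariant σ with τ(σ(τ x)) = τ x for all x — if and only if G has exactly one element or A has at most one element. -/
theorem exists_max_indep {G : Type*} [Group G] (s : G) (hs : s ≠ 1) :
    ∃ M : Set G, (∀ h, ¬ (h ∈ M ∧ s * h ∈ M)) ∧
      ∀ h, h ∉ M → s * h ∉ M → s * (s * h) ∉ M → False := by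
  obtain ⟨M, hM⟩ := zorn_subset {M : Set G | ∀ h, ¬ (h ∈ M ∧ s * h ∈ M)} (by
    intro c hc hch
    refine ⟨⋃₀ c, ?_, fun t ht => Set.subset_sUnion_of_mem ht⟩
    rintro h ⟨⟨t, ht, hht⟩, ⟨u, hu, hhu⟩⟩
    rcases hch.total ht hu with htu | htu
    · exact hc hu h ⟨htu hht, hhu⟩
    · exact hc ht h ⟨hht, htu hhu⟩)
  refine ⟨M, hM.prop, fun h h0 h1 h2 => ?_⟩
  have key : insert (s * h) M ∈ {M : Set G | ∀ h, ¬ (h ∈ M ∧ s * h ∈ M)} := by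
    rintro k ⟨hk | hk, hk' | hk'⟩
    · subst hk
      exact hs (by simpa using hk')
    · subst hk
      exact h2 hk'
    · have : k = h := mul_left_cancel hk'
      exact h0 (this ▸ hk)
    · exact hM.prop k ⟨hk, hk'⟩
  exact h1 (hM.le_of_ge key (Set.subset_insert _ _) (Set.mem_insert _ _))

/-- for a group `G` and a finite set `A`, the monoid of all continuous
`G`-equivariant self-maps of `A^G` is von Neumann regular iff `|G| = 1` or `|A| ≤ 1`. -/
theorem stmt_2 {G A : Type*} [Group G] [Finite A] :
    (∀ τ : (G → A) → (G → A), PDContinuous τ → Equivariant τ →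
      ∃ σ : (G → A) → (G → A), PDContinuous σ ∧ Equivariant σ ∧
        ∀ x : G → A, τ (σ (τ x)) = τ x) ↔
    (Subsingleton G ∨ Subsingleton A) := by
  classical
  constructor
  · intro H
    by_contra hcon
    rw [not_or, not_subsingleton_iff_nontrivial, not_subsingleton_iff_nontrivial] at hcon
    obtain ⟨hG, hA⟩ := hcon
    obtain ⟨s, hs⟩ := exists_ne (1 : G)
    obtain ⟨a, b, hab⟩ := exists_pair_ne A
    obtain ⟨M, hM1, hM2⟩ := exists_max_indep s hs
    let F : A × A × A → A := fun p => if p.1 = p.2.1 ∧ p.2.1 = p.2.2 then a else b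
    let τ : (G → A) → (G → A) := fun x h => F (x h, x (s * h), x (s * (s * h)))
    have hc : PDContinuous τ := by
      unfold PDContinuous
      letI : TopologicalSpace A := ⊥
      haveI : DiscreteTopology A := ⟨rfl⟩
      have : Continuous τ := by
        refine continuous_pi fun h => ?_
        have hF : Continuous F := continuous_of_discreteTopology
        exact hF.comp (by fun_prop)
      exact this
    have he : Equivariant τ := by
      intro x g
      funext h
      simp only [τ, confShift, mul_assoc]
    obtain ⟨σ, -, hσe, hσ⟩ := H τ hc he
    let x : G → A := fun h => if h ∈ M then a else b
    have hx : τ x = fun _ => b := by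
      funext h
      have h1 := hM1 h
      have h2 := hM1 (s * h)
      have h3 := hM2 h
      simp only [τ, F, x]
      rw [if_neg]
      by_cases i0 : h ∈ M <;> by_cases i1 : s * h ∈ M <;>
        by_cases i2 : s * (s * h) ∈ M <;> simp_all [hab.symm]
    have hconst : ∀ h, σ (fun _ => b) h = σ (fun _ => b) 1 := by
      intro h
      have := congrFun (hσe (fun _ => b) h) h
      have e : confShift (fun _ => b) h = (fun _ : G => b) := rfl
      rw [e] at this
      simpa [confShift] using this
    have h4 := congrFun (hσ x) 1
    rw [hx] at h4
    simp only [τ, F] at h4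
    rw [if_pos ⟨by rw [hconst (s * 1)], by rw [hconst (s * 1), hconst (s * (s * 1))]⟩] at h4
    exact hab h4
  · rintro (hG | hA) τ hτ hτe
    · refine ⟨fun y => if h : ∃ x, τ x = y then h.choose else y, ?_, ?_, ?_⟩
      · unfold PDContinuous
        letI : TopologicalSpace A := ⊥
        haveI : DiscreteTopology A := ⟨rfl⟩
        exact continuous_of_discreteTopology (α := G → A) (β := G → A)
      · intro x g
        have : ∀ y : G → A, confShift y g = y := by
          intro y
          funext h
          exact congrArg y (Subsingleton.elim _ _)
        rw [this, this]
      · intro x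
        have h : ∃ z, τ z = τ x := ⟨x, rfl⟩
        simp only [dif_pos h]
        exact h.choose_spec
    · exact ⟨τ, hτ, hτe, fun x => Subsingleton.elim _ _⟩
end

section
/- Let q ≥ 2 and let A = {0, 1, …, q−1} ⊆ ℕ with its usual linear order. Define τ₁, τ₂ : A^ℤ → A^ℤ by (τ₁ x)(i) = min{x(i−1), x(i), x(i+1)} and (τ₂ x)(i) = max{x(i−1), x(i), x(i+1)} for all x : ℤ → A and i ∈ ℤ. Then τ₁ and τ₂ are generalised inverses of each other: τ₁(τ₂(τ₁ x)) = τ₁ x and τ₂(τ₁(τ₂ x)) = τ₂ x for all x ∈ A^ℤ. -/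
/-- the min-CA `τ₁` and the max-CA `τ₂` over the alphabet
`{0, …, q−1}` (for `q ≥ 2`) and the group `ℤ`, with memory set `{−1,0,1}`,
are generalised inverses of each other. -/
theorem stmt_3 (q : ℕ) (hq : 2 ≤ q)
    (τ₁ τ₂ : (ℤ → Fin q) → (ℤ → Fin q))
    (h₁ : ∀ (x : ℤ → Fin q) (i : ℤ), τ₁ x i = min (x (i - 1)) (min (x i) (x (i + 1))))
    (h₂ : ∀ (x : ℤ → Fin q) (i : ℤ), τ₂ x i = max (x (i - 1)) (max (x i) (x (i + 1)))) :
    ∀ x : ℤ → Fin q, τ₁ (τ₂ (τ₁ x)) = τ₁ x ∧ τ₂ (τ₁ (τ₂ x)) = τ₂ x := by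
  have gc : GaloisConnection τ₂ τ₁ := by
    intro x y
    constructor
    · intro h i
      have a := h (i - 1)
      have b := h i
      have c := h (i + 1)
      rw [h₂] at a b c
      rw [h₁]
      simp only [max_le_iff, sub_add_cancel, add_sub_cancel_right] at a b c
      exact le_min a.2.2 (le_min b.2.1 c.1)
    · intro h i
      have a := h (i - 1)
      have b := h i
      have c := h (i + 1)
      rw [h₁] at a b c
      rw [h₂]
      simp only [le_min_iff, sub_add_cancel, add_sub_cancel_right] at a b c
      exact max_le a.2.2 (max_le b.2.1 c.1)
  intro x
  exact ⟨gc.u_l_u_eq_u x, gc.l_u_l_eq_l x⟩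
end

section
/- Let τ : (ℤ → Bool) → (ℤ → Bool) be the Rule 110 elementary cellular automaton, defined by (τ x)(i) = f(x(i−1), x(i), x(i+1)) where f : Bool³ → Bool is given by the truth table f(1,1,1)=0, f(1,1,0)=1, f(1,0,1)=1, f(1,0,0)=0, f(0,1,1)=1, f(0,1,0)=1, f(0,0,1)=1, f(0,0,0)=0 (equivalently f(a,b,c) = if a then (b XOR c) else (b OR c)). Then τ is not von Neumann regular in the monoid of continuous ℤ-equivariant self-maps of Bool^ℤ: there is no σ : (ℤ → Bool) → (ℤ → Bool) that is continuous (for the product topology with Bool discrete) and ℤ-equivariant and satisfies τ(σ(τ x)) = τ x for all x. -/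
/-- The right action of `ℤ` on `Bool^ℤ`: `(x · n)(m) = x (m − n)`. -/
def intShift {A : Type*} (x : ℤ → A) (n : ℤ) : ℤ → A :=
  fun m => x (m - n)

/-- A self-map of `Bool^ℤ` is `ℤ`-equivariant if it commutes with the shift. -/
def IntEquivariant {A : Type*} (σ : (ℤ → A) → (ℤ → A)) : Prop :=
  ∀ (x : ℤ → A) (n : ℤ), σ (intShift x n) = intShift (σ x) n

/-- Continuity for the prodiscrete topology on `A^ℤ` (product topology, `A` discrete). -/
def PDContinuousZ {A : Type*} (σ : (ℤ → A) → (ℤ → A)) : Prop :=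
  @Continuous _ _ (@Pi.topologicalSpace ℤ (fun _ => A) (fun _ => ⊥))
    (@Pi.topologicalSpace ℤ (fun _ => A) (fun _ => ⊥)) σ

/-- The Rule 110 elementary cellular automaton:
`(τ x)(i) = f (x (i−1)) (x i) (x (i+1))` with `f a b c = if a then b XOR c else b OR c`. -/
def rule110 : (ℤ → Bool) → (ℤ → Bool) :=
  fun x i => if x (i - 1) then xor (x i) (x (i + 1)) else (x i || x (i + 1))

/-- Rule 110 is not von Neumann regular in the monoid of continuous
`ℤ`-equivariant self-maps of `Bool^ℤ`. -/
theorem stmt_4 :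
    ¬ ∃ σ : (ℤ → Bool) → (ℤ → Bool), PDContinuousZ σ ∧ IntEquivariant σ ∧
        ∀ x : ℤ → Bool, rule110 (σ (rule110 x)) = rule110 x := by
  rintro ⟨σ, -, hE, h⟩
  have h1 : rule110 (fun i : ℤ => decide (i % 3 ≠ 0)) = fun _ => true := by
    funext i
    have h3 : i % 3 = 0 ∨ i % 3 = 1 ∨ i % 3 = 2 := by omega
    rcases h3 with h3 | h3 | h3
    · have a : (i - 1) % 3 = 2 := by omega
      have b : (i + 1) % 3 = 1 := by omega
      simp [rule110, h3, a, b]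
    · have a : (i - 1) % 3 = 0 := by omega
      have b : (i + 1) % 3 = 2 := by omega
      simp [rule110, h3, a, b]
    · have a : (i - 1) % 3 = 1 := by omega
      have b : (i + 1) % 3 = 0 := by omega
      simp [rule110, h3, a, b]
  have h2 := h (fun i : ℤ => decide (i % 3 ≠ 0))
  rw [h1] at h2
  have hc : ∀ n : ℤ, σ (fun _ => true) (-n) = σ (fun _ => true) 0 := by
    intro n
    have e := congrFun (hE (fun _ => true) n) 0
    simp only [intShift, zero_sub] at e
    exact e.symm
  have e0 := congrFun h2 0
  have ha := hc 1
  have hb := hc (-1)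
  simp only [neg_neg] at hb
  simp only [rule110, zero_sub, zero_add, ha, hb] at e0
  cases hh : σ (fun _ => true) 0 <;> simp [hh] at e0
end

section
/- Let G be a finite group of size at least 2 and A a finite set of size at least 2, and let x, y ∈ A^G. There exists a bijective G-equivariant map τ : A^G → A^G with τ(x) = y if and only if the stabilisers of x and y in G are equal: G_x = G_y. -/
/-- The stabiliser of a configuration `x ∈ A^G`: `{g ∈ G : x · g = x}`. -/
def confStab {G A : Type*} [Group G] (x : G → A) : Set G :=
  {g : G | confShift x g = x}

theorem confShift_mul {G A : Type*} [Group G] (x : G → A) (g k : G) :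
    confShift (confShift x g) k = confShift x (g * k) := by
  funext h
  simp [confShift, mul_assoc]

theorem confShift_one {G A : Type*} [Group G] (x : G → A) : confShift x 1 = x := by
  funext h
  simp [confShift]

theorem confShift_cancel {G A : Type*} [Group G] {z x : G → A} {g k : G}
    (h : confShift z k = confShift x g) : z = confShift x (g * k⁻¹) := by
  rw [← confShift_mul, ← h, confShift_mul, mul_inv_cancel, confShift_one]

theorem confShift_transfer {G A : Type*} [Group G] {x y : G → A}
    (hs : confStab x = confStab y) {g k : G} (h : confShift x g = confShift x k) :
    confShift y g = confShift y k := by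
  have h1 : k * g⁻¹ ∈ confStab x := (confShift_cancel h).symm
  rw [hs] at h1
  have h2 : confShift y (k * g⁻¹) = y := h1
  conv_lhs => rw [← h2]
  rw [confShift_mul, inv_mul_cancel_right]

theorem confStab_aux {G A : Type*} [Group G] {τ : (G → A) → (G → A)}
    (hi : Function.Injective τ) (he : Equivariant τ) (x : G → A) :
    confStab x = confStab (τ x) := by
  ext g
  change confShift x g = x ↔ confShift (τ x) g = τ x
  rw [← he x g, hi.eq_iff]

open Classical in
noncomputable def swapMap {G A : Type*} [Group G] (x y : G → A) (z : G → A) : G → A :=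
  if h : ∃ g, z = confShift x g then confShift y h.choose
  else if h : ∃ g, z = confShift y g then confShift x h.choose
  else z

theorem swapMap_left {G A : Type*} [Group G] {x y : G → A}
    (hs : confStab x = confStab y) (g : G) :
    swapMap x y (confShift x g) = confShift y g := by
  have h : ∃ k, confShift x g = confShift x k := ⟨g, rfl⟩
  rw [swapMap, dif_pos h]
  exact (confShift_transfer hs h.choose_spec).symm

theorem swapMap_right {G A : Type*} [Group G] {x y : G → A}
    (hs : confStab x = confStab y) (g : G) (hn : ¬ ∃ k, confShift y g = confShift x k) :
    swapMap x y (confShift y g) = confShift x g := by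
  have h : ∃ k, confShift y g = confShift y k := ⟨g, rfl⟩
  rw [swapMap, dif_neg hn, dif_pos h]
  exact (confShift_transfer hs.symm h.choose_spec).symm

theorem swapMap_other {G A : Type*} [Group G] {x y z : G → A}
    (hx : ¬ ∃ k, z = confShift x k) (hy : ¬ ∃ k, z = confShift y k) :
    swapMap x y z = z := by
  rw [swapMap, dif_neg hx, dif_neg hy]

theorem swapMap_equivariant {G A : Type*} [Group G] {x y : G → A}
    (hs : confStab x = confStab y) : Equivariant (swapMap x y) := by
  intro z k
  by_cases hx : ∃ g, z = confShift x g
  · obtain ⟨g, rfl⟩ := hx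
    rw [confShift_mul, swapMap_left hs, swapMap_left hs, confShift_mul]
  have hx' : ¬ ∃ g, confShift z k = confShift x g :=
    fun ⟨g, hg⟩ => hx ⟨_, confShift_cancel hg⟩
  by_cases hy : ∃ g, z = confShift y g
  · obtain ⟨g, rfl⟩ := hy
    rw [swapMap_right hs g hx, confShift_mul]
    rw [confShift_mul] at hx'
    rw [swapMap_right hs _ hx', confShift_mul]
  have hy' : ¬ ∃ g, confShift z k = confShift y g :=
    fun ⟨g, hg⟩ => hy ⟨_, confShift_cancel hg⟩
  rw [swapMap_other hx hy, swapMap_other hx' hy']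

theorem swapMap_surjective {G A : Type*} [Group G] {x y : G → A}
    (hs : confStab x = confStab y) : Function.Surjective (swapMap x y) := by
  intro w
  by_cases hy : ∃ g, w = confShift y g
  · obtain ⟨g, rfl⟩ := hy
    exact ⟨_, swapMap_left hs g⟩
  by_cases hx : ∃ g, w = confShift x g
  · obtain ⟨g, rfl⟩ := hx
    refine ⟨_, swapMap_right hs g ?_⟩
    rintro ⟨k, hk⟩
    apply hy
    refine ⟨g * k⁻¹ * g, ?_⟩
    rw [← confShift_mul]
    congr 1
    exact confShift_cancel hk.symm
  exact ⟨w, swapMap_other hx hy⟩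

/-- for finite `G`, `A` of size at least 2 and `x, y ∈ A^G`, there is a
bijective `G`-equivariant map `τ` with `τ x = y` iff `x` and `y` have equal stabilisers. -/
theorem stmt_6 {G A : Type*} [Group G] [Finite G] [Finite A]
    [Nontrivial G] [Nontrivial A] (x y : G → A) :
    (∃ τ : (G → A) → (G → A), Function.Bijective τ ∧ Equivariant τ ∧ τ x = y) ↔
      confStab x = confStab y := by
  constructor
  · rintro ⟨τ, hb, he, rfl⟩
    exact confStab_aux hb.1 he x
  · intro hs
    refine ⟨swapMap x y, ?_, swapMap_equivariant hs, ?_⟩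
    · exact Finite.surjective_iff_bijective.mp (swapMap_surjective hs)
    · have := swapMap_left hs 1
      rwa [confShift_one, confShift_one] at this
end

section
/- Let G be a finite group and A a finite set of size at least 2, and let R = {σ : A^G → A^G : σ is G-equivariant and G_{σ(x)} = G_x for all x ∈ A^G}. Then R is a von Neumann regular monoid: R is a submonoid of the monoid of G-equivariant self-maps of A^G, and for every τ ∈ R there exists φ ∈ R with τ(φ(τ x)) = τ x for all x ∈ A^G. -/
/-- Membership in the submonoid `R`: `σ` is `G`-equivariant and preserves stabilisers. -/
def MemR {G A : Type*} [Group G] (σ : (G → A) → (G → A)) : Prop :=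
  Equivariant σ ∧ ∀ x : G → A, confStab (σ x) = confStab x

theorem confShift_mul_aux {G A : Type*} [Group G] (x : G → A) (g h : G) :
    confShift (confShift x g) h = confShift x (g * h) := by
  funext t; simp [confShift, mul_assoc]

theorem confShift_one_aux {G A : Type*} [Group G] (x : G → A) :
    confShift x (1 : G) = x := by
  funext t; simp [confShift]

theorem confShift_eq_iff_aux {G A : Type*} [Group G] (x : G → A) (g h : G) :
    confShift x g = confShift x h ↔ g * h⁻¹ ∈ confStab x := by
  show _ ↔ confShift x (g * h⁻¹) = x
  constructor
  · intro e
    rw [← confShift_mul_aux, e, confShift_mul_aux, mul_inv_cancel, confShift_one_aux]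
  · intro e
    have := congrArg (fun z => confShift z h) e
    simpa [confShift_mul_aux] using this

/-- for finite `G` and finite `A` of size at least 2, the set
`R = {σ G-equivariant : G_{σ(x)} = G_x for all x}` is a submonoid of the monoid of
`G`-equivariant self-maps of `A^G` and is von Neumann regular. -/
theorem stmt_10 {G A : Type*} [Group G] [Finite G] [Finite A] [Nontrivial A] :
    MemR (id : (G → A) → (G → A)) ∧
    (∀ τ σ : (G → A) → (G → A), MemR τ → MemR σ → MemR (σ ∘ τ)) ∧
    (∀ τ : (G → A) → (G → A), MemR τ →
      ∃ φ : (G → A) → (G → A), MemR φ ∧ ∀ x : G → A, τ (φ (τ x)) = τ x) := by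
  classical
  refine ⟨⟨fun _ _ => rfl, fun _ => rfl⟩, ?_, ?_⟩
  · intro τ σ hτ hσ
    refine ⟨fun x g => ?_, fun x => ?_⟩
    · simp only [Function.comp, hτ.1 x g, hσ.1 (τ x) g]
    · simp only [Function.comp, hσ.2, hτ.2]
  · intro τ hτ
    have hq : ∀ r : G → A, ∃ p : G → A, confStab p = confStab r ∧
        ((∃ x, τ x = r) → τ p = r) := by
      intro r
      by_cases h : ∃ x, τ x = r
      · obtain ⟨x, rfl⟩ := h
        exact ⟨x, (hτ.2 x).symm, fun _ => rfl⟩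
      · exact ⟨r, rfl, fun h' => absurd h' h⟩
    choose q hq1 hq2 using hq
    let S : Setoid (G → A) :=
      { r := fun x y => ∃ g : G, confShift x g = y
        iseqv :=
          { refl := fun x => ⟨1, confShift_one_aux x⟩
            symm := by
              rintro x y ⟨g, rfl⟩
              exact ⟨g⁻¹, by rw [confShift_mul_aux, mul_inv_cancel, confShift_one_aux]⟩
            trans := by
              rintro x y z ⟨g, rfl⟩ ⟨h, rfl⟩
              exact ⟨g * h, (confShift_mul_aux x g h).symm⟩ } }
    let r : (G → A) → (G → A) := fun y => (Quotient.mk S y).out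
    have hr : ∀ y, ∃ g : G, confShift (r y) g = y := fun y => Quotient.mk_out (s := S) y
    have hrg : ∀ y g, r (confShift y g) = r y := by
      intro y g
      have : Quotient.mk S (confShift y g) = Quotient.mk S y :=
        (Quotient.sound (s := S) (show ∃ k : G, confShift y k = confShift y g from ⟨g, rfl⟩)).symm
      simp only [r, this]
    choose k hk using hr
    have key : ∀ (y : G → A) (g h : G), confShift (q y) g = confShift (q y) h ↔
        confShift y g = confShift y h := by
      intro y g h
      rw [confShift_eq_iff_aux, confShift_eq_iff_aux, hq1]
    refine ⟨fun y => confShift (q (r y)) (k y), ⟨fun y g => ?_, fun y => ?_⟩, fun x => ?_⟩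
    · show confShift (q (r (confShift y g))) (k (confShift y g)) = _
      have h1 := hk (confShift y g)
      rw [hrg] at h1 ⊢
      rw [confShift_mul_aux, key, h1, ← confShift_mul_aux, hk]
    · ext g
      show confShift (confShift (q (r y)) (k y)) g = confShift (q (r y)) (k y) ↔
        confShift y g = y
      rw [confShift_mul_aux, key, ← confShift_mul_aux, hk]
    · show τ (confShift (q (r (τ x))) (k (τ x))) = τ x
      rw [hτ.1, hq2, hk]
      refine ⟨confShift x (k (τ x))⁻¹, ?_⟩
      rw [hτ.1]
      have e := hk (τ x)
      have e2 := congrArg (fun z => confShift z (k (τ x))⁻¹) e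
      simp only [confShift_mul_aux, mul_inv_cancel, confShift_one_aux] at e2
      exact e2.symm
end

section
/- Let G be a group, F a field, and V a nontrivial finite-dimensional vector space over F. The ring End_F(V)[G] (the monoid algebra MonoidAlgebra (Module.End F V) G, which is isomorphic as an F-algebra to the monoid LCA(G;V) of linear cellular automata over G and V) is von Neumann regular — i.e. every element a admits b with a * b * a = a — if and only if G is locally finite and the characteristic of F does not divide the order o(g) of g, for every g ∈ G. -/
open MonoidAlgebra in
theorem aux_finite_regular {H : Type*} [Group H] [Finite H] {F R : Type*} [Field F] [Ring R]
    [Algebra F R] [IsSemisimpleRing R] (hH : (Nat.card H : F) ≠ 0) (a : MonoidAlgebra R H) :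
    ∃ b, a * b * a = a := by
  classical
  have := Fintype.ofFinite H
  have e : MonoidAlgebra R H ≃ₗ[R] (H →₀ R) :=
    { coeffAddEquiv with map_smul' := fun r x => rfl }
  have hss : IsSemisimpleModule R (MonoidAlgebra R H) := IsSemisimpleModule.congr e
  let I : Submodule R (MonoidAlgebra R H) := (Ideal.span {a}).restrictScalars R
  obtain ⟨J, hJ⟩ := exists_isCompl I
  obtain ⟨p, hp⟩ : ∃ p : MonoidAlgebra R H →ₗ[R] I, ∀ x : I, p x = x :=
    ⟨I.projectionOnto J hJ, fun x => by simp⟩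
  have hmem : ∀ x, ∃ y, (p x : MonoidAlgebra R H) = y * a := fun x => by
    obtain ⟨y, hy⟩ := Ideal.mem_span_singleton'.1 (show (p x : MonoidAlgebra R H) ∈ Ideal.span {a} from (p x).2)
    exact ⟨y, hy.symm⟩
  have hpa : ∀ h : H, (p (single h 1 * a) : MonoidAlgebra R H) = single h 1 * a := fun h => by
    have hm : single h 1 * a ∈ I := Ideal.mul_mem_left _ _ (Ideal.mem_span_singleton_self a)
    exact congrArg Subtype.val (hp ⟨_, hm⟩)
  have key : ∀ x : MonoidAlgebra R H,
      x * (∑ h : H, single h⁻¹ (1:R) * (p (single h 1) : MonoidAlgebra R H))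
       = ∑ h : H, single h⁻¹ (1:R) * (p (single h 1 * x) : MonoidAlgebra R H) := by
    intro x
    induction x using MonoidAlgebra.induction_linear with
    | zero => simp
    | add x y hx hy => simp [add_mul, mul_add, hx, hy, Finset.sum_add_distrib]
    | single g r =>
      rw [Finset.mul_sum]
      refine Fintype.sum_bijective (· * g⁻¹) (Group.mulRight_bijective g⁻¹) _ _ fun h => ?_
      have : single (h * g⁻¹) (1:R) * single g r = r • single h (1:R) := by
        simp [single_mul_single]
      rw [this, map_smul, ← mul_assoc, single_mul_single]
      have h2 : ((r • p (single h 1) : I) : MonoidAlgebra R H) = single 1 r * (p (single h 1) : MonoidAlgebra R H) := by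
        rw [Submodule.coe_smul]
        ext m
        simp
      rw [h2, ← mul_assoc, single_mul_single]
      simp
  choose y hy using hmem
  have h1 := key a
  simp only [hpa] at h1
  simp only [← mul_assoc, single_mul_single, inv_mul_cancel, mul_one, hy] at h1
  rw [← one_def] at h1
  simp only [one_mul, Finset.sum_const, Finset.card_univ, ← Finset.sum_mul] at h1
  rw [← Nat.card_eq_fintype_card, ← Nat.cast_smul_eq_nsmul F, ← mul_assoc] at h1
  refine ⟨(Nat.card H : F)⁻¹ • (∑ h : H, single h⁻¹ (1:R) * y (single h 1)), ?_⟩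
  rw [mul_smul_comm, smul_mul_assoc, h1, smul_smul, inv_mul_cancel₀ hH, one_smul]

open MonoidAlgebra in
theorem aux_annihilator {G R : Type*} [Group G] [Ring R]
    (hreg : ∀ a : MonoidAlgebra R G, ∃ b, a * b * a = a)
    (ε : MonoidAlgebra R G →+* R) (T : Finset (MonoidAlgebra R G)) (hT : ∀ t ∈ T, ε t = 0) :
    ∃ f, ε f = 1 ∧ ∀ t ∈ T, t * f = 0 := by
  classical
  induction T using Finset.induction_on with
  | empty => exact ⟨1, by simp⟩
  | insert t T _ ih =>
    obtain ⟨f, hf, hT'⟩ := ih fun s hs => hT s (Finset.mem_insert_of_mem hs)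
    have ht := hT t (Finset.mem_insert_self _ _)
    obtain ⟨b, hb⟩ := hreg (t * f)
    refine ⟨f * (1 - b * (t * f)), by simp [hf, ht], fun s hs => ?_⟩
    rw [← mul_assoc]
    rcases Finset.mem_insert.1 hs with rfl | hs
    · rw [mul_sub, mul_one, ← mul_assoc, hb, sub_self]
    · rw [hT' s hs, zero_mul]

open MonoidAlgebra in
theorem aux_sum {G R : Type*} [Group G] [Ring R] (H : Subgroup G) [Finite H] (f : G →₀ R)
    (hf : ∀ h ∈ H, ∀ x, f (h * x) = f x) : ∃ c : R, (f.sum fun _ r => r) = (Nat.card H) • c := by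
  classical
  have := Fintype.ofFinite H
  rw [Finsupp.sum, ← Finset.sum_fiberwise_of_maps_to
    (t := f.support.image (Quotient.mk (QuotientGroup.rightRel H)))
    (g := Quotient.mk (QuotientGroup.rightRel H)) fun x hx => Finset.mem_image_of_mem _ hx]
  suffices h : ∀ q ∈ f.support.image (Quotient.mk (QuotientGroup.rightRel H)), ∃ c : R,
      ∑ x ∈ f.support with Quotient.mk (QuotientGroup.rightRel H) x = q, f x = (Nat.card H) • c by
    choose! c hc using h
    exact ⟨_, by rw [Finset.sum_congr rfl hc, ← Finset.smul_sum]⟩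
  intro q hq
  obtain ⟨x0, hx0, rfl⟩ := Finset.mem_image.1 hq
  refine ⟨f x0, ?_⟩
  have : (f.support.filter fun x => Quotient.mk (QuotientGroup.rightRel H) x = Quotient.mk _ x0)
      = Finset.univ.image fun h : H => (h : G) * x0 := by
    ext x
    simp only [Finset.mem_filter, Finset.mem_image, Finset.mem_univ, true_and, Quotient.eq,
      QuotientGroup.rightRel_apply]
    constructor
    · rintro ⟨-, h⟩
      exact ⟨⟨x * x0⁻¹, by simpa using H.inv_mem h⟩, by simp⟩
    · rintro ⟨h, rfl⟩
      refine ⟨?_, by simp⟩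
      rw [Finsupp.mem_support_iff] at hx0 ⊢
      rwa [hf h h.2]
  rw [this, Finset.sum_image (fun a _ b _ h => Subtype.ext (mul_right_cancel h))]
  rw [Finset.sum_congr rfl fun h _ => hf h.1 h.2 x0]
  simp [Nat.card_eq_fintype_card]

open MonoidAlgebra in
theorem aux_forward {G R : Type*} [Group G] [Ring R] [Nontrivial R]
    (hreg : ∀ a : MonoidAlgebra R G, ∃ b, a * b * a = a) (H : Subgroup G) (hH : H.FG) :
    Finite H ∧ ∃ c : R, 1 = (Nat.card H) • c := by
  classical
  obtain ⟨S, hS⟩ := hH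
  let ε : MonoidAlgebra R G →+* R := liftNCRingHom (RingHom.id R) 1 (fun x y => by simp)
  have hε : ∀ x, ε x = x.coeff.sum fun _ r => r := by
    intro x
    induction x using MonoidAlgebra.induction_linear with
    | zero => simp
    | add x y hx hy => rw [map_add, hx, hy, coeff_add, Finsupp.sum_add_index'] <;> simp
    | single g r => simp [ε]
  obtain ⟨f, hf1, hf⟩ := aux_annihilator hreg ε (S.image fun g => single g 1 - 1) (by
    intro t ht
    obtain ⟨g, -, rfl⟩ := Finset.mem_image.1 ht
    simp [ε])
  have hinv : ∀ h ∈ H, single h 1 * f = f := by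
    intro h hh
    rw [← hS] at hh
    induction hh using Subgroup.closure_induction with
    | mem g hg =>
      have := hf _ (Finset.mem_image_of_mem _ hg)
      rwa [sub_mul, one_mul, sub_eq_zero] at this
    | one => rw [← one_def, one_mul]
    | mul x y _ _ hx hy =>
      rw [← mul_one (1:R), ← single_mul_single, mul_assoc, hy, hx]
    | inv x _ hx =>
      conv_lhs => rw [← hx]
      rw [← mul_assoc, single_mul_single, inv_mul_cancel, mul_one, ← one_def, one_mul]
  have hinv' : ∀ h ∈ H, ∀ x, f.coeff (h * x) = f.coeff x := by
    intro h hh x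
    conv_lhs => rw [← hinv h hh]
    simp
  have hne : f.coeff ≠ 0 := by
    intro h0
    rw [hε, h0] at hf1
    simp at hf1
  obtain ⟨x, hx⟩ := Finsupp.ne_iff.1 hne
  have hfin : Finite H := by
    refine Finite.of_injective (β := f.coeff.support)
      (fun h => ⟨(h:G) * x, by rw [Finsupp.mem_support_iff, hinv' h h.2]; exact hx⟩) ?_
    intro a b hab
    exact Subtype.ext (mul_right_cancel (congrArg Subtype.val hab))
  refine ⟨hfin, ?_⟩
  obtain ⟨c, hc⟩ := aux_sum H f.coeff hinv'
  exact ⟨c, by rw [← hc, ← hε, hf1]⟩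

open MonoidAlgebra in
/-- for a group `G`, a field `F` and a nontrivial finite-dimensional
`F`-vector space `V`, the group ring `End_F(V)[G]` (isomorphic to the monoid
`LCA(G;V)` of linear cellular automata) is von Neumann regular iff `G` is locally
finite and `Char F ∤ o(g)` for every `g ∈ G`. -/
theorem stmt_14 {G : Type*} [Group G] {F V : Type*} [Field F]
    [AddCommGroup V] [Module F V] [Nontrivial V] [FiniteDimensional F V] :
    (∀ a : MonoidAlgebra (Module.End F V) G,
        ∃ b : MonoidAlgebra (Module.End F V) G, a * b * a = a) ↔
      ((∀ H : Subgroup G, H.FG → Finite H) ∧ ∀ g : G, ¬ (ringChar F ∣ orderOf g)) := by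
  classical
  constructor
  · intro hreg
    refine ⟨fun H hH => (aux_forward hreg H hH).1, fun g hg => ?_⟩
    obtain ⟨_, c, hc⟩ := aux_forward hreg (Subgroup.zpowers g) ⟨{g}, by simp [Subgroup.zpowers_eq_closure]⟩
    rw [Nat.card_zpowers, ← Nat.cast_smul_eq_nsmul F, (ringChar.spec F _).2 hg, zero_smul] at hc
    exact one_ne_zero hc
  · rintro ⟨hlf, hchar⟩ a
    let H : Subgroup G := Subgroup.closure (a.coeff.support : Set G)
    have hfin : Finite H := hlf H ⟨_, rfl⟩
    have hss : IsSemisimpleRing (Module.End F V) := IsSemisimpleRing.moduleEnd F V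
    have hcard : (Nat.card H : F) ≠ 0 := by
      intro h0
      have hd := (ringChar.spec F _).1 h0
      rcases CharP.char_is_prime_or_zero F (ringChar F) with hp | hp
      · have := Fact.mk hp
        obtain ⟨x, hx⟩ := exists_prime_orderOf_dvd_card' (ringChar F) hd
        exact hchar x (by rw [Subgroup.orderOf_coe, hx])
      · rw [hp, zero_dvd_iff] at hd
        exact Nat.card_pos.ne' hd
    obtain ⟨a', ha'⟩ : ∃ a', mapDomainRingHom (Module.End F V) H.subtype a' = a := by
      have : ∀ x : MonoidAlgebra (Module.End F V) G, x = x.coeff.sum single := by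
        intro x; ext; simp
      rw [this a, Finsupp.sum]
      change _ ∈ (mapDomainRingHom (Module.End F V) H.subtype).range
      refine sum_mem fun g hg => ?_
      exact ⟨single ⟨g, Subgroup.subset_closure hg⟩ (a.coeff g), by simp⟩
    obtain ⟨b, hb⟩ := aux_finite_regular hcard a'
    exact ⟨mapDomainRingHom _ H.subtype b, by rw [← ha', ← map_mul, ← map_mul, hb]⟩
end

section
/- Let G be a group, F a field of characteristic 0, and V a nontrivial finite-dimensional vector space over F. The ring End_F(V)[G] (the monoid algebra MonoidAlgebra (Module.End F V) G, which is isomorphic as an F-algebra to the monoid LCA(G;V) of linear cellular automata over G and V) is von Neumann regular if and only if G is locally finite. -/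
theorem stmt15_aux1 {G R : Type*} [Group G] [Ring R] [Nontrivial R]
    (hreg : ∀ a : MonoidAlgebra R G, ∃ b : MonoidAlgebra R G, a * b * a = a)
    (H : Subgroup G) (hH : H.FG) : Finite H := by
  obtain ⟨S, hS, hfin⟩ := (Subgroup.fg_iff H).1 hH
  let aug : MonoidAlgebra R G →+* R :=
    MonoidAlgebra.liftNCRingHom (RingHom.id R) (1 : G →* R) (fun x y => by simp)
  have haug : ∀ g : G, aug (MonoidAlgebra.single g 1) = 1 := fun g => by
    simp [aug, MonoidAlgebra.liftNCRingHom_single]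
  have key : ∃ u : MonoidAlgebra R G, aug u = 1 ∧
      ∀ t ∈ S, MonoidAlgebra.single t 1 * u = u := by
    induction S, hfin using Set.Finite.induction_on generalizing H with
    | empty => exact ⟨1, by simp, by simp⟩
    | @insert g T hg hT ih =>
      obtain ⟨u, hu, hut⟩ := ih (Subgroup.closure T)
        ((Subgroup.fg_iff _).2 ⟨T, rfl, hT⟩) rfl
      obtain ⟨b, hb⟩ := hreg ((MonoidAlgebra.single g 1 - 1) * u)
      refine ⟨u - u * (b * ((MonoidAlgebra.single g 1 - 1) * u)), ?_, ?_⟩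
      · simp [hu, haug]
      · intro t ht
        rcases ht with rfl | ht
        · have h0 : (MonoidAlgebra.single t 1 - 1) *
              (u - u * (b * ((MonoidAlgebra.single t 1 - 1) * u))) = 0 := by
            rw [mul_sub, ← mul_assoc _ u, ← mul_assoc _ b, hb, sub_self]
          rwa [sub_mul, one_mul, sub_eq_zero] at h0
        · rw [mul_sub, ← mul_assoc _ u, hut t ht]
  obtain ⟨u, hu, hut⟩ := key
  have hinv : ∀ h ∈ H, MonoidAlgebra.single h 1 * u = u := by
    intro h hh
    rw [← hS] at hh
    induction hh using Subgroup.closure_induction with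
    | mem x hx => exact hut x hx
    | one => rw [← MonoidAlgebra.one_def, one_mul]
    | mul x y _ _ hx hy =>
      have : (MonoidAlgebra.single (x * y) 1 : MonoidAlgebra R G)
          = MonoidAlgebra.single x 1 * MonoidAlgebra.single y 1 := by
        rw [MonoidAlgebra.single_mul_single, one_mul]
      rw [this, mul_assoc, hy, hx]
    | inv x _ hx =>
      conv_lhs => rw [← hx]
      rw [← mul_assoc, MonoidAlgebra.single_mul_single, inv_mul_cancel, one_mul,
        ← MonoidAlgebra.one_def, one_mul]
  have hne : u ≠ 0 := by
    rintro rfl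
    simp at hu
  obtain ⟨k, hk⟩ : ∃ k, u.coeff k ≠ 0 := by
    by_contra! hcon
    exact hne (by ext k; simp [hcon k])
  have hmem : ∀ h : H, (h : G) * k ∈ u.coeff.support := by
    intro h
    rw [Finsupp.mem_support_iff]
    have h1 := congrArg (fun x => x.coeff ((h : G) * k)) (hinv h h.2)
    simp only [MonoidAlgebra.coeff_single_mul_apply, one_mul, inv_mul_cancel_left] at h1
    rwa [← h1]
  exact Finite.of_injective (fun h : H => (⟨(h : G) * k, hmem h⟩ : u.coeff.support))
    (fun x y hxy => by
      simp only [Subtype.mk.injEq, mul_left_inj] at hxy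
      exact Subtype.ext hxy)

theorem stmt15_aux2 {G R F : Type*} [Group G] [Ring R] [IsSemisimpleRing R] [Field F]
    [CharZero F] [Algebra F R]
    (hG : ∀ H : Subgroup G, H.FG → Finite H) (a : MonoidAlgebra R G) :
    ∃ b : MonoidAlgebra R G, a * b * a = a := by
  classical
  let H : Subgroup G := Subgroup.closure (a.coeff.support : Set G)
  have hfin : Finite H := hG H ⟨a.coeff.support, rfl⟩
  have := Fintype.ofFinite H
  let I : Ideal (MonoidAlgebra R G) := Ideal.span {a}
  let P : Submodule R (MonoidAlgebra R G) := I.restrictScalars R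
  have : IsSemisimpleModule R (MonoidAlgebra R G) := inferInstance
  obtain ⟨Q, hQ⟩ := ComplementedLattice.exists_isCompl P
  let p : MonoidAlgebra R G →ₗ[R] MonoidAlgebra R G := P.projection Q hQ
  have hp1 : ∀ x, p x ∈ I := fun x => Submodule.projection_apply_mem hQ x
  have hp2 : ∀ x ∈ I, p x = x := fun x hx => Submodule.projection_apply_left hQ ⟨x, hx⟩
  let φ : MonoidAlgebra R G → MonoidAlgebra R G := fun x =>
    ∑ h : H, MonoidAlgebra.single (h : G)⁻¹ 1 * p (MonoidAlgebra.single (h : G) 1 * x)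
  have hφI : ∀ x, φ x ∈ I := fun x => I.sum_mem fun h _ => I.mul_mem_left _ (hp1 _)
  have hφa : φ a = (Fintype.card H : F) • a := by
    have : ∀ h : H, MonoidAlgebra.single (h : G)⁻¹ 1 *
        p (MonoidAlgebra.single (h : G) 1 * a) = a := by
      intro h
      rw [hp2 _ (I.mul_mem_left _ (Ideal.subset_span rfl)), ← mul_assoc,
        MonoidAlgebra.single_mul_single, inv_mul_cancel, one_mul, ← MonoidAlgebra.one_def,
        one_mul]
    simp only [φ, this]
    simp [Nat.cast_smul_eq_nsmul]
  have hcomm : ∀ (g : G) (r : R) (x : MonoidAlgebra R G),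
      MonoidAlgebra.single g 1 * (r • x) = r • (MonoidAlgebra.single g 1 * x) := by
    intro g r x
    ext k
    simp
  have hφs : ∀ (k : G) (r : R), k ∈ H →
      φ (MonoidAlgebra.single k r) = MonoidAlgebra.single k r * φ 1 := by
    intro k r hk
    have hs : (MonoidAlgebra.single k r : MonoidAlgebra R G)
        = r • MonoidAlgebra.single k 1 := by simp
    rw [hs, smul_mul_assoc]
    simp only [φ, hcomm, map_smul, ← Finset.smul_sum]
    congr 1
    rw [Finset.mul_sum]
    refine Fintype.sum_equiv (Equiv.mulRight (⟨k, hk⟩ : H)) _ _ fun h => ?_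
    simp [← mul_assoc, MonoidAlgebra.single_mul_single]
  have hφadd : ∀ (s : Finset G) (f : G → MonoidAlgebra R G),
      φ (∑ i ∈ s, f i) = ∑ i ∈ s, φ (f i) := by
    intro s f
    simp only [φ, Finset.mul_sum, map_sum]
    rw [Finset.sum_comm]
  have hφ : φ a = a * φ 1 := by
    have ha : a = ∑ k ∈ a.coeff.support, MonoidAlgebra.single k (a.coeff k) :=
      (MonoidAlgebra.sum_coeff_single a).symm
    calc φ a = φ (∑ k ∈ a.coeff.support, MonoidAlgebra.single k (a.coeff k)) := by rw [← ha]
      _ = ∑ k ∈ a.coeff.support, MonoidAlgebra.single k (a.coeff k) * φ 1 := by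
        rw [hφadd]
        exact Finset.sum_congr rfl fun k hk => hφs k _ (Subgroup.subset_closure hk)
      _ = a * φ 1 := by rw [← Finset.sum_mul, ← ha]
  obtain ⟨b, hb⟩ := Ideal.mem_span_singleton'.1 (hφI 1)
  have hc : (Fintype.card H : F) ≠ 0 := by
    exact_mod_cast Fintype.card_ne_zero
  refine ⟨(Fintype.card H : F)⁻¹ • b, ?_⟩
  rw [mul_smul_comm, smul_mul_assoc, mul_assoc, hb, ← hφ, hφa, smul_smul,
    inv_mul_cancel₀ hc, one_smul]


/-- for a group `G`, a field `F` of characteristic `0` and a nontrivial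
finite-dimensional `F`-vector space `V`, the group ring `End_F(V)[G]` (isomorphic to
the monoid `LCA(G;V)` of linear cellular automata) is von Neumann regular iff `G` is
locally finite. -/
theorem stmt_15 {G : Type*} [Group G] {F V : Type*} [Field F] [CharZero F]
    [AddCommGroup V] [Module F V] [Nontrivial V] [FiniteDimensional F V] :
    (∀ a : MonoidAlgebra (Module.End F V) G,
        ∃ b : MonoidAlgebra (Module.End F V) G, a * b * a = a) ↔
      (∀ H : Subgroup G, H.FG → Finite H) := by
  have : IsSemisimpleRing (Module.End F V) := IsSemisimpleRing.moduleEnd F V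
  exact ⟨fun h => stmt15_aux1 h, fun h => stmt15_aux2 (F := F) h⟩
end

section
/- Let F be a finite field with q elements, let n ≥ 2 be an integer with Char(F) ∣ n, and suppose X^n − 1 factors in F[X] as X^n − 1 = p₁^{m₁} · p₂^{m₂} ⋯ p_r^{m_r}, where p₁, …, p_r are pairwise distinct monic irreducible polynomials, m_i ≥ 1, and d_i = deg p_i. Then the number of von Neumann regular elements of the quotient ring F[X]/⟨X^n − 1⟩ — i.e. the cardinality of {a : ∃ b, a * b * a = a} — equals ∏_{i=1}^{r} ((q^{d_i} − 1) · q^{d_i(m_i − 1)} + 1). -/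
open Polynomial

lemma aux_card {F : Type*} [Field F] [Fintype F] (f : F[X]) (hf : f ≠ 0) :
    Finite (F[X] ⧸ Ideal.span {f}) ∧
    Nat.card (F[X] ⧸ Ideal.span {f}) = Fintype.card F ^ f.natDegree := by
  have : Module.Finite F (F[X] ⧸ Ideal.span {f}) :=
    Module.Finite.of_basis (AdjoinRoot.powerBasis hf).basis
  refine ⟨Module.finite_of_finite F, ?_⟩
  rw [Module.natCard_eq_pow_finrank (K := F), finrank_quotient_span_eq_natDegree,
    Nat.card_eq_fintype_card]

lemma aux_local {F : Type*} [Field F] [Fintype F] (p : F[X]) (hp : Irreducible p) (m : ℕ)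
    (hm : 1 ≤ m) :
    Nat.card {a : F[X] ⧸ Ideal.span {p ^ m} // ∃ b, a * b * a = a} =
      (Fintype.card F ^ p.natDegree - 1) * Fintype.card F ^ (p.natDegree * (m - 1)) + 1 := by
  obtain ⟨hfin, hcard⟩ := aux_card (p ^ m) (pow_ne_zero _ hp.ne_zero)
  obtain ⟨hfin1, hcard1⟩ := aux_card p hp.ne_zero
  have hle : Ideal.span {p ^ m} ≤ Ideal.span {p} := by
    rw [Ideal.span_singleton_le_span_singleton]
    exact dvd_pow_self p (by omega)
  let φ := Ideal.Quotient.factor hle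
  have hφ : Function.Surjective φ := Ideal.Quotient.factor_surjective hle
  have hker : ∀ f : F[X], φ (Ideal.Quotient.mk _ f) = 0 ↔ p ∣ f := fun f => by
    simp only [φ, Ideal.Quotient.factor_mk, Ideal.Quotient.eq_zero_iff_mem,
      Ideal.mem_span_singleton]
  have hset : {a : F[X] ⧸ Ideal.span {p ^ m} | ∃ b, a * b * a = a} =
      insert 0 ((φ.toAddMonoidHom.ker : Set (F[X] ⧸ Ideal.span {p ^ m}))ᶜ) := by
    ext a
    obtain ⟨f, rfl⟩ := Ideal.Quotient.mk_surjective a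
    have e1 : (Ideal.Quotient.mk (Ideal.span {p ^ m}) f ∈ φ.toAddMonoidHom.ker) ↔ p ∣ f :=
      hker f
    simp only [Set.mem_ofPred_eq, Set.mem_insert_iff, Set.mem_compl_iff, SetLike.mem_coe, e1]
    constructor
    · rintro ⟨b, hb⟩
      obtain ⟨g, rfl⟩ := Ideal.Quotient.mk_surjective b
      by_cases h : p ∣ f
      · left
        rw [← map_mul, ← map_mul, Ideal.Quotient.eq, Ideal.mem_span_singleton] at hb
        rw [Ideal.Quotient.eq_zero_iff_mem, Ideal.mem_span_singleton]
        obtain ⟨c, rfl⟩ := h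
        have : IsCoprime (p ^ m) (g * (p * c) - 1) :=
          IsCoprime.pow_left ⟨g * c, -1, by ring⟩
        exact this.dvd_of_dvd_mul_right (by convert hb using 1; ring)
      · exact Or.inr h
    · rintro (h | h)
      · exact ⟨0, by simp [h]⟩
      · have : IsCoprime (p ^ m) f := IsCoprime.pow_left ((hp.coprime_iff_not_dvd).2 h)
        obtain ⟨u, v, huv⟩ := this
        refine ⟨Ideal.Quotient.mk _ v, ?_⟩
        rw [← map_mul, ← map_mul, Ideal.Quotient.eq, Ideal.mem_span_singleton]
        exact ⟨-u * f, by linear_combination f * huv⟩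
  have hk : Nat.card φ.toAddMonoidHom.ker * Fintype.card F ^ p.natDegree =
      Fintype.card F ^ (m * p.natDegree) := by
    have hr : φ.toAddMonoidHom.range = ⊤ := AddMonoidHom.range_eq_top.2 hφ
    have := φ.toAddMonoidHom.ker.card_mul_index
    rw [AddSubgroup.index_ker, hr, AddSubgroup.card_top, hcard1,
      hcard, natDegree_pow] at this
    exact this
  have hq : 0 < Fintype.card F := Fintype.card_pos
  have hk2 : Nat.card φ.toAddMonoidHom.ker = Fintype.card F ^ (p.natDegree * (m - 1)) := by
    apply Nat.eq_of_mul_eq_mul_right (pow_pos hq p.natDegree)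
    rw [hk, ← pow_add]
    congr 1
    obtain ⟨k, rfl⟩ := Nat.exists_eq_add_of_le' hm
    simp; ring
  change Nat.card ({a : F[X] ⧸ Ideal.span {p ^ m} | ∃ b, a * b * a = a} : Set _) = _
  rw [hset, Nat.card_coe_set_eq, Set.ncard_insert_of_notMem (by simp) (Set.toFinite _),
    Set.ncard_compl, hcard, ← Nat.card_coe_set_eq]
  change _ - Nat.card φ.toAddMonoidHom.ker + 1 = _
  rw [natDegree_pow, ← hk, hk2, Nat.sub_mul, one_mul, mul_comm]

/-- let `F` be a finite field of size `q`, `n ≥ 2` with `Char F ∣ n`,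
and let `X^n − 1 = ∏ pᵢ^{mᵢ}` be a factorization into powers of pairwise distinct
monic irreducible polynomials with `dᵢ = deg pᵢ`. Then the number of von Neumann
regular elements of `F[X]/⟨X^n − 1⟩` is `∏ ((q^{dᵢ} − 1) q^{dᵢ(mᵢ−1)} + 1)`. -/
theorem stmt_17 {F : Type*} [Field F] [Fintype F] (q : ℕ) (hq : Fintype.card F = q)
    (n : ℕ) (hn : 2 ≤ n) (hchar : ringChar F ∣ n)
    (r : ℕ) (p : Fin r → F[X]) (m d : Fin r → ℕ)
    (hmonic : ∀ i, (p i).Monic) (hirr : ∀ i, Irreducible (p i))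
    (hdistinct : ∀ i j, i ≠ j → p i ≠ p j)
    (hm : ∀ i, 1 ≤ m i) (hd : ∀ i, (p i).natDegree = d i)
    (hfact : (X ^ n - 1 : F[X]) = ∏ i, p i ^ m i) :
    Nat.card {a : F[X] ⧸ Ideal.span {(X ^ n - 1 : F[X])} // ∃ b, a * b * a = a} =
      ∏ i, ((q ^ d i - 1) * q ^ (d i * (m i - 1)) + 1) := by
  have hcop : Pairwise (Function.onFun IsCoprime (fun i => p i ^ m i)) := by
    intro i j hij
    refine IsCoprime.pow ((hirr i).coprime_iff_not_dvd.2 fun h => hdistinct i j hij ?_)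
    exact eq_of_monic_of_associated (hmonic i) (hmonic j)
      ((hirr i).associated_of_dvd (hirr j) h)
  have hI : Ideal.span {(X ^ n - 1 : F[X])} = ⨅ i, Ideal.span {p i ^ m i} := by
    rw [hfact, Ideal.iInf_span_singleton hcop]
  let e : (F[X] ⧸ Ideal.span {(X ^ n - 1 : F[X])}) ≃+* ∀ i, F[X] ⧸ Ideal.span {p i ^ m i} :=
    (Ideal.quotEquivOfEq hI).trans (Ideal.quotientInfRingEquivPiQuotient _ fun i j hij =>
      (Ideal.isCoprime_span_singleton_iff _ _).2 (hcop hij))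
  have e2 : {a : F[X] ⧸ Ideal.span {(X ^ n - 1 : F[X])} // ∃ b, a * b * a = a} ≃
      {a : ∀ i, F[X] ⧸ Ideal.span {p i ^ m i} // ∀ i, ∃ b, a i * b * a i = a i} := by
    refine e.toEquiv.subtypeEquiv fun a => ?_
    constructor
    · rintro ⟨b, hb⟩ i
      refine ⟨e b i, ?_⟩
      have := congrFun (congrArg e hb) i
      simpa using this
    · intro h
      choose b hb using h
      refine ⟨e.symm b, e.injective ?_⟩
      ext i
      simpa using hb i
  have e3 : {a : ∀ i, F[X] ⧸ Ideal.span {p i ^ m i} // ∀ i, ∃ b, a i * b * a i = a i} ≃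
      ∀ i, {a : F[X] ⧸ Ideal.span {p i ^ m i} // ∃ b, a * b * a = a} :=
    Equiv.subtypePiEquivPi (p := fun i (a : F[X] ⧸ Ideal.span {p i ^ m i}) => ∃ b, a * b * a = a)
  rw [Nat.card_congr e2, Nat.card_congr e3, Nat.card_pi]
  refine Finset.prod_congr rfl fun i _ => ?_
  rw [aux_local (p i) (hirr i) (m i) (hm i), hq, hd]
end
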